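/- Let d ≥ 1 and p_1,...,p_d > 0 with Σ_i p_i ≤ 1, and let X = (X_1,...,X_d) be a centered Gaussian vector with covariance Σ = diag(p) − p pᵀ. Then for m = 1, E[Π_{i=1}^d X_i²] ≥ Π_{i=1}^d E[X_i²] = Π_{i=1}^d p_i(1−p_i). -/

import Mathlib

open MeasureTheory ProbabilityTheory

namespace GPI

open MvPolynomial

noncomputable section

variable {n : ℕ}

/-- standard Gaussian on ℝ -/
abbrev gam : Measure ℝ := gaussianReal 0 1

/-- standard Gaussian on ℝⁿ -/
abbrev gamN (n : ℕ) : Measure (Fin n → ℝ) := Measure.pi (fun _ => gam)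

lemma integrable_pow (k : ℕ) : Integrable (fun x : ℝ => x ^ k) gam := by
  have h := (memLp_id_gaussianReal (μ := 0) (v := 1) (k : NNReal))
  rcases Nat.eq_zero_or_pos k with rfl | hk
  · simp
  have h2 := h.integrable_norm_rpow (by simpa using hk.ne') (by simp)
  have h3 : Integrable (fun x : ℝ => ‖x ^ k‖) gam := by
    refine h2.congr (ae_of_all _ fun x => ?_)
    simp
  exact (integrable_norm_iff (by fun_prop)).1 h3

lemma integrable_pow_pdf (k : ℕ) :
    Integrable (fun x : ℝ => x ^ k * gaussianPDFReal 0 1 x) := by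
  have h := integrable_pow k
  rw [gam, gaussianReal_of_var_ne_zero 0 (one_ne_zero)] at h
  rw [integrable_withDensity_iff_integrable_smul' (measurable_gaussianPDF 0 1)
    (ae_of_all _ fun x => gaussianPDF_lt_top)] at h
  refine h.congr (ae_of_all _ fun x => ?_)
  simp [toReal_gaussianPDF, mul_comm]

lemma moment_succ (k : ℕ) :
    ∫ x, x ^ (k + 1) ∂gam = k * ∫ x, x ^ (k - 1) ∂gam := by
  have e : ∀ j : ℕ, ∫ x, x ^ j ∂gam = ∫ x : ℝ, x ^ j * gaussianPDFReal 0 1 x := by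
    intro j
    rw [gam, integral_gaussianReal_eq_integral_smul one_ne_zero]
    simp [mul_comm]
  have hd : ∀ x : ℝ, HasDerivAt (fun x : ℝ => x ^ k * gaussianPDFReal 0 1 x)
      ((k * (x ^ (k - 1) * gaussianPDFReal 0 1 x)) - x ^ (k + 1) * gaussianPDFReal 0 1 x) x := by
    intro x
    have h1 : HasDerivAt (fun x : ℝ => gaussianPDFReal 0 1 x) (-x * gaussianPDFReal 0 1 x) x := by
      simp only [gaussianPDFReal_def]
      have : HasDerivAt (fun x : ℝ => -(x - 0) ^ 2 / (2 * ((1 : NNReal) : ℝ))) (-x) x := by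
        have := (((hasDerivAt_id x).sub_const 0).pow 2).neg.div_const (2 * ((1 : NNReal) : ℝ))
        refine this.congr_deriv ?_
        simp
        ring
      refine (this.exp.const_mul _).congr_deriv ?_
      ring
    refine ((hasDerivAt_pow k x).mul h1).congr_deriv ?_
    ring
  have h := integral_eq_zero_of_hasDerivAt_of_integrable hd
    (((integrable_pow_pdf (k - 1)).const_mul _).sub (integrable_pow_pdf (k + 1)))
    (integrable_pow_pdf k)
  rw [integral_sub ((integrable_pow_pdf (k - 1)).const_mul _) (integrable_pow_pdf (k + 1)),
    integral_const_mul] at h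
  rw [e, e]
  linarith

/-- Gaussian expectation of a polynomial. -/
def E (f : MvPolynomial (Fin n) ℝ) : ℝ := ∫ z, eval z f ∂(gamN n)

lemma integrable_eval (f : MvPolynomial (Fin n) ℝ) :
    Integrable (fun z => eval z f) (gamN n) := by
  induction f using MvPolynomial.induction_on' with
  | monomial u a =>
    simp only [eval_monomial, Finsupp.prod_fintype _ _ (fun i => pow_zero _)]
    refine Integrable.const_mul ?_ a
    exact Integrable.fintype_prod (f := fun i x => x ^ (u i)) (fun i => integrable_pow _)
  | add p q hp hq => 
    simp only [map_add]
    exact hp.add hq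

lemma E_add (f g : MvPolynomial (Fin n) ℝ) : E (f + g) = E f + E g := by
  simp only [E, map_add]
  exact integral_add (integrable_eval f) (integrable_eval g)

lemma E_sub (f g : MvPolynomial (Fin n) ℝ) : E (f - g) = E f - E g := by
  simp only [E, map_sub]
  exact integral_sub (integrable_eval f) (integrable_eval g)

lemma E_C_mul (c : ℝ) (g : MvPolynomial (Fin n) ℝ) : E (C c * g) = c * E g := by
  simp only [E, map_mul, eval_C]
  exact integral_const_mul _ _

lemma E_sum {ι : Type*} (s : Finset ι) (f : ι → MvPolynomial (Fin n) ℝ) :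
    E (∑ i ∈ s, f i) = ∑ i ∈ s, E (f i) := by
  simp only [E, map_sum]
  exact integral_finsetSum _ fun i _ => integrable_eval (f i)

lemma E_sq_nonneg (f : MvPolynomial (Fin n) ℝ) : 0 ≤ E (f * f) := by
  simp only [E, map_mul]
  exact integral_nonneg fun z => mul_self_nonneg _

lemma E_one : E (1 : MvPolynomial (Fin n) ℝ) = 1 := by
  simp [E]

lemma E_monomial (u : Fin n →₀ ℕ) (a : ℝ) :
    E (monomial u a) = a * ∏ i, ∫ x, x ^ (u i) ∂gam := by
  simp only [E, eval_monomial, Finsupp.prod_fintype _ _ (fun i => pow_zero _)]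
  rw [integral_const_mul, integral_fintype_prod_eq_prod (fun i x => x ^ (u i))]

lemma stein_X (i : Fin n) (f : MvPolynomial (Fin n) ℝ) :
    E (X i * f) = E (pderiv i f) := by
  induction f using MvPolynomial.induction_on' with
  | monomial u a =>
    rw [pderiv_monomial, X, monomial_mul, E_monomial, E_monomial,
      ← Finset.mul_prod_erase _ (fun j => ∫ x, x ^ ((Finsupp.single i 1 + u : Fin n →₀ ℕ) j) ∂gam)
        (Finset.mem_univ i),
      ← Finset.mul_prod_erase _
        (fun j => ∫ x, x ^ ((u - Finsupp.single i 1 : Fin n →₀ ℕ) j) ∂gam) (Finset.mem_univ i)]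
    have h : ∏ x ∈ Finset.univ.erase i, ∫ y, y ^ ((Finsupp.single i 1 + u : Fin n →₀ ℕ) x) ∂gam
      = ∏ x ∈ Finset.univ.erase i, ∫ y, y ^ ((u - Finsupp.single i 1 : Fin n →₀ ℕ) x) ∂gam := by
      refine Finset.prod_congr rfl fun j hj => ?_
      have : i ≠ j := (Finset.ne_of_mem_erase hj).symm
      simp [Finsupp.single_apply, this]
    rw [h]
    have h2 : (Finsupp.single i 1 + u : Fin n →₀ ℕ) i = u i + 1 := by simp [add_comm]
    have h3 : (u - Finsupp.single i 1 : Fin n →₀ ℕ) i = u i - 1 := by simp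
    rw [h2, h3, moment_succ]
    ring
  | add p q hp hq => rw [mul_add, E_add, hp, hq, map_add, E_add]

/-- linear form -/
def lin (v : Fin n → ℝ) : MvPolynomial (Fin n) ℝ := ∑ i, C (v i) * X i

/-- directional derivative -/
def D (v : Fin n → ℝ) : Derivation ℝ (MvPolynomial (Fin n) ℝ) (MvPolynomial (Fin n) ℝ) :=
  mkDerivation ℝ (fun i => C (v i))

lemma D_eq (v : Fin n → ℝ) (f : MvPolynomial (Fin n) ℝ) :
    D v f = ∑ i, C (v i) * pderiv i f := by
  induction f using MvPolynomial.induction_on with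
  | C a => simp [D]
  | add p q hp hq => simp [hp, hq, mul_add, Finset.sum_add_distrib]
  | mul_X p i hp =>
    simp only [Derivation.leibniz, hp, smul_eq_mul, mul_add, Finset.sum_add_distrib]
    congr 1
    · simp [D, pderiv_X, Pi.single_apply, mul_comm]
    · rw [Finset.mul_sum]
      exact Finset.sum_congr rfl fun j _ => by ring

lemma D_C (v : Fin n → ℝ) (c : ℝ) : D v (C c) = 0 := by simp [D]

lemma D_C_mul (v : Fin n → ℝ) (c : ℝ) (f : MvPolynomial (Fin n) ℝ) :
    D v (C c * f) = C c * D v f := by simp [Derivation.leibniz]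

lemma D_lin (u v : Fin n → ℝ) : D u (lin v) = C (∑ i, u i * v i) := by
  simp only [lin, map_sum, D_C_mul]
  refine Finset.sum_congr rfl fun i _ => ?_
  simp [D, mul_comm]

lemma D_comm (u v : Fin n → ℝ) (f : MvPolynomial (Fin n) ℝ) :
    D u (D v f) = D v (D u f) := by
  induction f using MvPolynomial.induction_on with
  | C a => simp [D]
  | add p q hp hq => simp [hp, hq]
  | mul_X p i hp =>
    have h : ∀ w : Fin n → ℝ, D w (X i) = C (w i) := fun w => by simp [D]
    simp only [Derivation.leibniz, smul_eq_mul, map_add, h, D_C, hp]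
    ring

lemma stein (v : Fin n → ℝ) (f : MvPolynomial (Fin n) ℝ) : E (lin v * f) = E (D v f) := by
  rw [D_eq, lin, Finset.sum_mul, E_sum, E_sum]
  refine Finset.sum_congr rfl fun i _ => ?_
  rw [mul_assoc, E_C_mul, E_C_mul, stein_X]

/-- creation operator -/
def cr (v : Fin n → ℝ) (f : MvPolynomial (Fin n) ℝ) : MvPolynomial (Fin n) ℝ :=
  lin v * f - D v f

lemma adj (v : Fin n → ℝ) (f g : MvPolynomial (Fin n) ℝ) :
    E (cr v f * g) = E (f * D v g) := by
  have h : cr v f * g = lin v * (f * g) - D v f * g := by rw [cr]; ring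
  rw [h, E_sub, stein, Derivation.leibniz, E_add, smul_eq_mul, smul_eq_mul, mul_comm g]
  ring

lemma D_cr (u v : Fin n → ℝ) (f : MvPolynomial (Fin n) ℝ) :
    D u (cr v f) = cr v (D u f) + C (∑ i, u i * v i) * f := by
  simp only [cr, map_sub, Derivation.leibniz, smul_eq_mul, D_lin, D_comm u v f]
  ring

/-- Wick product of linear forms -/
def psi : List (Fin n → ℝ) → MvPolynomial (Fin n) ℝ
  | [] => 1
  | v :: L => cr v (psi L)

lemma psi_norm (L : List (Fin n → ℝ)) :
    (L.map fun v => ∑ i, v i * v i).prod ≤ E (psi L * psi L) := by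
  induction L with
  | nil => simp [psi, E_one]
  | cons v L ih =>
    have h : E (psi (v :: L) * psi (v :: L)) =
        E (D v (psi L) * D v (psi L)) + (∑ i, v i * v i) * E (psi L * psi L) := by
      rw [psi, adj, D_cr, mul_add, E_add, mul_comm (psi L) (cr _ _), adj]
      congr 1
      rw [← E_C_mul]
      congr 1
      ring
    rw [h, List.map_cons, List.prod_cons]
    have h1 := E_sq_nonneg (D v (psi L))
    have h2 := mul_le_mul_of_nonneg_left ih
      (Finset.sum_nonneg fun i (_ : i ∈ Finset.univ) => mul_self_nonneg (v i))
    linarith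

/-- degree less than `k` -/
def K : ℕ → MvPolynomial (Fin n) ℝ → Prop
  | 0, q => q = 0
  | k + 1, q => ∀ v, K k (D v q)

lemma K_zero (k : ℕ) : K k (0 : MvPolynomial (Fin n) ℝ) := by
  induction k with
  | zero => rfl
  | succ k ih => intro v; simpa using ih

lemma K_sub {k : ℕ} : ∀ {p q : MvPolynomial (Fin n) ℝ}, K k p → K k q → K k (p - q) := by
  induction k with
  | zero => intro p q hp hq; simp only [K] at *; simp [hp, hq]
  | succ k ih => intro p q hp hq v; rw [map_sub]; exact ih (hp v) (hq v)

lemma K_add {k : ℕ} : ∀ {p q : MvPolynomial (Fin n) ℝ}, K k p → K k q → K k (p + q) := by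
  induction k with
  | zero => intro p q hp hq; simp only [K] at *; simp [hp, hq]
  | succ k ih => intro p q hp hq v; rw [map_add]; exact ih (hp v) (hq v)

lemma K_C_mul {k : ℕ} (c : ℝ) : ∀ {p : MvPolynomial (Fin n) ℝ}, K k p → K k (C c * p) := by
  induction k with
  | zero => intro p hp; simp only [K] at *; simp [hp]
  | succ k ih => intro p hp v; rw [D_C_mul]; exact ih (hp v)

lemma K_succ {k : ℕ} : ∀ {p : MvPolynomial (Fin n) ℝ}, K k p → K (k + 1) p := by
  induction k with
  | zero => intro p hp; simp only [K] at *; simp [hp]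
  | succ k ih => intro p hp v; exact ih (hp v)

lemma K_lin {k : ℕ} (v : Fin n → ℝ) :
    ∀ {p : MvPolynomial (Fin n) ℝ}, K k p → K (k + 1) (lin v * p) := by
  induction k with
  | zero => intro p hp; simp only [K] at *; simp [hp]
  | succ k ih =>
    intro p hp u
    rw [Derivation.leibniz, D_lin, smul_eq_mul, smul_eq_mul, mul_comm p]
    exact K_add (ih (hp u)) (K_C_mul _ hp)

lemma K_psi (L : List (Fin n → ℝ)) : K (L.length + 1) (psi L) := by
  induction L with
  | nil => intro v; simp [psi, K]
  | cons v L ih =>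
    exact K_sub (K_lin v ih) (K_succ (K_succ (ih v)))

lemma K_diff (L : List (Fin n → ℝ)) : K L.length ((L.map lin).prod - psi L) := by
  induction L with
  | nil => simp [psi, K]
  | cons v L ih =>
    have h : ((v :: L).map lin).prod - psi (v :: L) =
        lin v * ((L.map lin).prod - psi L) + D v (psi L) := by
      rw [List.map_cons, List.prod_cons, psi, cr]; ring
    rw [h]
    exact K_add (K_lin v ih) (K_succ (K_psi L v))

lemma psi_orth (L : List (Fin n → ℝ)) :
    ∀ q, K L.length q → E (psi L * q) = 0 := by
  induction L with
  | nil => intro q hq; simp only [List.length_nil, K] at hq; simp [hq, E]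
  | cons v L ih => intro q hq; rw [psi, adj]; exact ih _ (hq v)

lemma main_list (L : List (Fin n → ℝ)) :
    (L.map fun v => ∑ i, v i * v i).prod ≤ E ((L.map lin).prod * (L.map lin).prod) := by
  refine (psi_norm L).trans ?_
  have h := psi_orth L _ (K_diff L)
  have h2 := E_sq_nonneg ((L.map lin).prod - psi L)
  have h3 : (L.map lin).prod * (L.map lin).prod = psi L * psi L
      + C 2 * (psi L * ((L.map lin).prod - psi L))
      + ((L.map lin).prod - psi L) * ((L.map lin).prod - psi L) := by
    rw [show (C 2 : MvPolynomial (Fin n) ℝ) = 2 from map_ofNat C 2]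
    ring
  rw [h3, E_add, E_add, E_C_mul, h]
  linarith

lemma main_gauss (V : Fin n → Fin n → ℝ) :
    ∏ i, ∑ j, V i j * V i j ≤ ∫ z, ∏ i, (∑ j, V i j * z j) ^ 2 ∂(gamN n) := by
  have h := main_list (List.ofFn V)
  rw [List.map_ofFn, List.prod_ofFn, List.map_ofFn, List.prod_ofFn] at h
  refine h.trans (le_of_eq ?_)
  rw [E]
  refine integral_congr_ae (ae_of_all _ fun z => ?_)
  simp [lin, pow_two, Finset.prod_mul_distrib]

lemma law_eq {Ω : Type*} [MeasurableSpace Ω] (P : Measure Ω) [IsProbabilityMeasure P]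
    (X : Fin n → Ω → ℝ) (hX : ∀ i, Measurable (X i)) (V : Fin n → Fin n → ℝ)
    (h : ∀ a : Fin n → ℝ, P.map (fun ω => ∑ i, a i * X i ω) =
      gaussianReal 0 (Real.toNNReal (∑ j, (∑ i, a i * V i j) ^ 2))) :
    P.map (fun ω i => X i ω) = (gamN n).map (fun z i => ∑ j, V i j * z j) := by
  have m1 : Measurable (fun ω i => X i ω) := measurable_pi_lambda _ hX
  have m2 : Measurable (fun (z : Fin n → ℝ) i => ∑ j, V i j * z j) := by fun_prop
  have := Measure.isProbabilityMeasure_map (μ := P) m1.aemeasurable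
  have := Measure.isProbabilityMeasure_map (μ := gamN n) m2.aemeasurable
  refine Measure.ext_of_charFunDual ?_
  ext L
  have hL : ∀ x, L x = ∑ i, L (Pi.single i 1) * x i := by
    intro x
    conv_lhs => rw [pi_eq_sum_univ' x, map_sum]
    refine Finset.sum_congr rfl fun i _ => ?_
    rw [map_smul, smul_eq_mul, mul_comm]
  set a : Fin n → ℝ := fun i => L (Pi.single i 1) with ha
  have e1 : charFunDual (P.map (fun ω i => X i ω)) L =
      charFun (P.map (fun ω => ∑ i, a i * X i ω)) 1 := by
    rw [charFunDual_apply, charFun_apply_real, integral_map m1.aemeasurable (by fun_prop),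
      integral_map (Measurable.aemeasurable (by fun_prop)) (by fun_prop)]
    refine integral_congr_ae (ae_of_all _ fun ω => ?_)
    simp only []
    rw [hL]
    simp [ha]
  have e2 : charFunDual ((gamN n).map (fun z i => ∑ j, V i j * z j)) L =
      ∏ j, charFun gam (∑ i, a i * V i j) := by
    simp only [charFun_apply_real]
    rw [charFunDual_apply, integral_map m2.aemeasurable (by fun_prop),
      ← integral_fintype_prod_eq_prod
        (fun j (x : ℝ) => Complex.exp (((∑ i, a i * V i j : ℝ) : ℂ) * (x : ℂ) * Complex.I))]
    refine integral_congr_ae (ae_of_all _ fun z => ?_)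
    simp only []
    rw [hL, ← Complex.exp_sum, ← Finset.sum_mul]
    congr 2
    push_cast
    simp only [Finset.mul_sum, Finset.sum_mul]
    rw [Finset.sum_comm]
    exact Finset.sum_congr rfl fun i _ => Finset.sum_congr rfl fun j _ => by ring
  rw [e1, e2, h a, charFun_gaussianReal]
  simp only [gam, charFun_gaussianReal]
  rw [← Complex.exp_sum]
  congr 1
  rw [Real.coe_toNNReal _ (Finset.sum_nonneg fun j _ => sq_nonneg _)]
  push_cast
  simp [Finset.sum_div]

end

end GPI


/-- The GPI for the centered Gaussian vector with multinomial covariance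
`Σ = diag(p) - p pᵀ` (characterized by its one-dimensional projections `aᵀX`,
which are Gaussian with variance `aᵀΣa = Σᵢ aᵢ² pᵢ - (Σᵢ aᵢ pᵢ)²`), in the case `m = 1`:
`E[∏ᵢ Xᵢ²] ≥ ∏ᵢ E[Xᵢ²] = ∏ᵢ pᵢ(1 - pᵢ)`. -/
theorem gpi_multinomial_m_one {Ω : Type*} [MeasureSpace Ω]
    [IsProbabilityMeasure (ℙ : Measure Ω)]
    (d : ℕ) (hd : 1 ≤ d) (p : Fin d → ℝ) (hp : ∀ i, 0 < p i) (hps : ∑ i, p i ≤ 1)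
    (X : Fin d → Ω → ℝ) (hX : ∀ i, Measurable (X i))
    (hgauss : ∀ a : Fin d → ℝ,
      Measure.map (fun ω => ∑ i, a i * X i ω) ℙ =
        gaussianReal 0
          (Real.toNNReal (∑ i, (a i) ^ 2 * p i - (∑ i, a i * p i) ^ 2))) :
    ((∫ ω, ∏ i, (X i ω) ^ 2) ≥ ∏ i, ∫ ω, (X i ω) ^ 2) ∧
      (∏ i, ∫ ω, (X i ω) ^ 2) = ∏ i, p i * (1 - p i) := by
  classical
  obtain ⟨c, hc⟩ : ∃ c : ℝ, 1 - 2 * c + c ^ 2 * ∑ i, p i = 0 := by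
    have hP : 0 < ∑ i, p i :=
      Finset.sum_pos (fun i _ => hp i) ⟨⟨0, hd⟩, Finset.mem_univ _⟩
    refine ⟨(1 - √(1 - ∑ i, p i)) / ∑ i, p i, ?_⟩
    have hs := Real.sq_sqrt (sub_nonneg.2 hps)
    field_simp
    linarith
  set V : Fin d → Fin d → ℝ := fun i j =>
    (if i = j then √(p i) else 0) - c * p i * √(p j) with hV
  have hVa : ∀ a : Fin d → ℝ, ∑ j, (∑ i, a i * V i j) ^ 2 =
      ∑ i, (a i) ^ 2 * p i - (∑ i, a i * p i) ^ 2 := by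
    intro a
    set s := ∑ i, a i * p i with hs
    have h1 : ∀ j, ∑ i, a i * V i j = √(p j) * (a j - c * s) := by
      intro j
      simp only [hV, mul_sub, Finset.sum_sub_distrib, mul_ite, mul_zero, Finset.sum_ite_eq',
        Finset.mem_univ, if_true, hs, Finset.mul_sum]
      congr 1
      · ring
      · exact Finset.sum_congr rfl fun i _ => by ring
    have h2 : ∀ j, (∑ i, a i * V i j) ^ 2 =
        (a j) ^ 2 * p j - 2 * c * s * (a j * p j) + c ^ 2 * s ^ 2 * p j := by
      intro j
      rw [h1, mul_pow, Real.sq_sqrt (hp j).le]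
      ring
    simp only [h2, Finset.sum_add_distrib, Finset.sum_sub_distrib, ← Finset.mul_sum, ← hs]
    linear_combination s ^ 2 * hc
  have hdiag : ∀ i, ∑ j, V i j * V i j = p i * (1 - p i) := by
    intro i
    have h := hVa (Pi.single i 1)
    simp only [Pi.single_apply, ite_mul, one_mul, zero_mul, Finset.sum_ite_eq',
      Finset.mem_univ, if_true, ite_pow, one_pow, ne_eq, OfNat.ofNat_ne_zero, not_false_eq_true,
      zero_pow] at h
    simp only [← pow_two, h]
    ring
  have hlaw := GPI.law_eq ℙ X hX V (by intro a; rw [hgauss a, hVa a])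
  have hmarg : ∀ i, ∫ ω, (X i ω) ^ 2 = p i * (1 - p i) := by
    intro i
    have h := hgauss (Pi.single i 1)
    simp only [Pi.single_apply, ite_mul, one_mul, zero_mul, Finset.sum_ite_eq',
      Finset.mem_univ, if_true, ite_pow, one_pow, ne_eq, OfNat.ofNat_ne_zero, not_false_eq_true,
      zero_pow] at h
    have hnn : 0 ≤ p i - p i ^ 2 := by
      have := hdiag i
      have h0 : 0 ≤ ∑ j, V i j * V i j := Finset.sum_nonneg fun j _ => mul_self_nonneg _
      nlinarith
    have h2 : ∫ ω, (X i ω) ^ 2 = ∫ x, x ^ 2 ∂(Measure.map (fun ω => X i ω) ℙ) := by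
      rw [integral_map (hX i).aemeasurable (by fun_prop)]
    rw [h2, h]
    have h3 := variance_fun_id_gaussianReal (μ := 0) (v := Real.toNNReal (p i - p i ^ 2))
    rw [variance_eq_integral (by fun_prop)] at h3
    simp only [integral_id_gaussianReal, sub_zero] at h3
    rw [h3, Real.coe_toNNReal _ hnn]
    ring
  have hsnd : (∏ i, ∫ ω, (X i ω) ^ 2) = ∏ i, p i * (1 - p i) :=
    Finset.prod_congr rfl fun i _ => hmarg i
  refine ⟨?_, hsnd⟩
  rw [hsnd]
  have hm := GPI.main_gauss V
  simp only [hdiag] at hm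
  refine le_of_le_of_eq hm ?_
  have m1 : Measurable (fun ω i => X i ω) := measurable_pi_lambda _ hX
  have m2 : Measurable (fun (z : Fin d → ℝ) i => ∑ j, V i j * z j) := by fun_prop
  have m3 : Measurable (fun x : Fin d → ℝ => ∏ i, (x i) ^ 2) :=
    Finset.measurable_prod _ fun i _ => (measurable_pi_apply i).pow_const 2
  have e1 : ∫ ω, ∏ i, (X i ω) ^ 2 =
      ∫ x, ∏ i, (x i) ^ 2 ∂(Measure.map (fun ω i => X i ω) ℙ) := by
    rw [integral_map m1.aemeasurable m3.aestronglyMeasurable]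
  rw [e1, hlaw, integral_map m2.aemeasurable m3.aestronglyMeasurable]
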